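/- arXiv:2605.30867 — 3 statements merged into one kernel-verified Lean document; each statement's English description precedes it below -/
import Mathlib

section
/- Let n ≥ 4 be an integer. For 1 ≤ j ≤ ⌊(n−1)/2⌋ define M_j^{(1)} = ∑_{(a,b) : (a,b,j) ∈ E_n^{(1)}} θ_{n,(a,b,j)} and M_j^{(2)} = ∑_{(a,b) : (a,b,j) ∈ E_n^{(2)}} θ_{n,(a,b,j)}, and for n = 2m even define M_m^{(3)} = ∑_{(a,b) : (a,b,m) ∈ E_n^{(3)}} θ_{n,(a,b,m)}. Then M_j^{(1)} = j − 1; M_j^{(2)} = 0 if 3j < n, M_j^{(2)} = 1/3 if 3j = n, and M_j^{(2)} = 3j − n if 3j > n; and in the even case M_m^{(3)} = m − 1. -/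
/-- `N_{(a,b,c)}`: the number of distinct ordered triples obtained by permuting `(a,b,c)`. -/
def Ntriple (p : ℕ × ℕ × ℕ) : ℕ :=
  ({(p.1, p.2.1, p.2.2), (p.1, p.2.2, p.2.1), (p.2.1, p.1, p.2.2),
    (p.2.1, p.2.2, p.1), (p.2.2, p.1, p.2.1), (p.2.2, p.2.1, p.1)} : Finset (ℕ × ℕ × ℕ)).card

/-- The weight `θ_{n,(a,b,c)} = N_{(a,b,c)}/3`. -/
noncomputable def thetaTri (p : ℕ × ℕ × ℕ) : ℝ := (Ntriple p : ℝ) / 3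

/-- `w_{n,(a,b,c)} = sin²(πa/n) + sin²(πb/n) + sin²(πc/n)`. -/
noncomputable def wTri (n : ℕ) (p : ℕ × ℕ × ℕ) : ℝ :=
  Real.sin (Real.pi * p.1 / n) ^ 2 + Real.sin (Real.pi * p.2.1 / n) ^ 2 +
    Real.sin (Real.pi * p.2.2 / n) ^ 2

/-- `A_{n,(a,b,c)}^{(c)} = w²/(4(sin²(πa/n)+sin²(πb/n)))`. -/
noncomputable def AcTri (n : ℕ) (p : ℕ × ℕ × ℕ) : ℝ :=
  wTri n p ^ 2 / (4 * (Real.sin (Real.pi * p.1 / n) ^ 2 + Real.sin (Real.pi * p.2.1 / n) ^ 2))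

/-- `A_{n,(a,b,c)}^{(b)} = w²/(4(sin²(πa/n)+sin²(πc/n)))`. -/
noncomputable def AbTri (n : ℕ) (p : ℕ × ℕ × ℕ) : ℝ :=
  wTri n p ^ 2 / (4 * (Real.sin (Real.pi * p.1 / n) ^ 2 + Real.sin (Real.pi * p.2.2 / n) ^ 2))

/-- The index set `E_n`: triples `1 ≤ a ≤ b ≤ c ≤ ⌊n/2⌋` with `a+b = c` or `a+b+c = n`.
For odd `n = 2m+1` this is `E_n^{(1)} ∪ E_n^{(2)}`, and for even `n = 2m` it is
`E_n^{(1)} ∪ E_n^{(2)} ∪ E_n^{(3)}` (triples of `E_n^{(2)}` with `c = m` satisfy `a+b = m = c`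
and hence coincide with `E_n^{(3)}`). -/
def Etri (n : ℕ) : Finset (ℕ × ℕ × ℕ) :=
  (Finset.range (n / 2 + 1) ×ˢ Finset.range (n / 2 + 1) ×ˢ Finset.range (n / 2 + 1)).filter
    fun p => 1 ≤ p.1 ∧ p.1 ≤ p.2.1 ∧ p.2.1 ≤ p.2.2 ∧
      (p.1 + p.2.1 = p.2.2 ∨ p.1 + p.2.1 + p.2.2 = n)

/-- `Q_{n,3}(x) = (1/n³)·∑_{(a,b,c)∈E_n} θ_{n,(a,b,c)}·w_{n,(a,b,c)}·x_a·x_b·x_c`. -/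
noncomputable def Q3 (n : ℕ) (x : ℕ → ℝ) : ℝ :=
  (1 / (n : ℝ) ^ 3) * ∑ p ∈ Etri n, thetaTri p * wTri n p * x p.1 * x p.2.1 * x p.2.2

/-- `Q_{n,2}`: for odd `n = 2m+1`, `(2/n²)·∑_{k=1}^{m}(k−1)·sin²(πk/n)·x_k²`; for even
`n = 2m`, `(2/n²)·∑_{k=1}^{m−1}(k−1)·sin²(πk/n)·x_k² + ((m−1)/n²)·x_m²`. -/
noncomputable def Q2 (n : ℕ) (x : ℕ → ℝ) : ℝ :=
  if n % 2 = 1 then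
    (2 / (n : ℝ) ^ 2) * ∑ k ∈ Finset.Icc 1 (n / 2),
      ((k : ℝ) - 1) * Real.sin (Real.pi * k / n) ^ 2 * x k ^ 2
  else
    (2 / (n : ℝ) ^ 2) * ∑ k ∈ Finset.Icc 1 (n / 2 - 1),
      ((k : ℝ) - 1) * Real.sin (Real.pi * k / n) ^ 2 * x k ^ 2
    + (((n / 2 : ℕ) : ℝ) - 1) / (n : ℝ) ^ 2 * x (n / 2) ^ 2

/-- `Q_{n,4}`: for odd `n = 2m+1`, `(2/n⁴)(∑_{k=1}^m x_k²)(∑_{k=1}^m sin²(πk/n)x_k²)`; for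
even `n = 2m`, `(2/n⁴)(∑_{k=1}^{m−1} x_k² + x_m²/2)(∑_{k=1}^{m−1} sin²(πk/n)x_k² + x_m²/2)`. -/
noncomputable def Q4 (n : ℕ) (x : ℕ → ℝ) : ℝ :=
  if n % 2 = 1 then
    (2 / (n : ℝ) ^ 4) * (∑ k ∈ Finset.Icc 1 (n / 2), x k ^ 2) *
      (∑ k ∈ Finset.Icc 1 (n / 2), Real.sin (Real.pi * k / n) ^ 2 * x k ^ 2)
  else
    (2 / (n : ℝ) ^ 4) * ((∑ k ∈ Finset.Icc 1 (n / 2 - 1), x k ^ 2) + x (n / 2) ^ 2 / 2) *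
      ((∑ k ∈ Finset.Icc 1 (n / 2 - 1), Real.sin (Real.pi * k / n) ^ 2 * x k ^ 2)
        + x (n / 2) ^ 2 / 2)

theorem theta_lt {a b c : ℕ} (h : a < b) (h' : b < c) : thetaTri (a, b, c) = 2 := by
  have h1 : a ≠ b := by omega
  have h2 : b ≠ c := by omega
  have h3 : a ≠ c := by omega
  have : Ntriple (a, b, c) = 6 := by
    simp [Ntriple, Finset.card_insert_of_notMem, h1, h2, h3, h1.symm, h2.symm, h3.symm]
  rw [thetaTri, this]; norm_num

theorem theta_left {a c : ℕ} (h : a < c) : thetaTri (a, a, c) = 1 := by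
  have h3 : a ≠ c := by omega
  have : Ntriple (a, a, c) = 3 := by
    have e : ({(a, a, c), (a, c, a), (a, a, c), (a, c, a), (c, a, a), (c, a, a)} :
        Finset (ℕ × ℕ × ℕ)) = {(a, a, c), (a, c, a), (c, a, a)} := by
      ext x; simp only [Finset.mem_insert, Finset.mem_singleton]; tauto
    simp only [Ntriple, e]
    simp [Finset.card_insert_of_notMem, h3, h3.symm]
  rw [thetaTri, this]; norm_num

theorem theta_right {a c : ℕ} (h : a < c) : thetaTri (a, c, c) = 1 := by
  have h3 : a ≠ c := by omega
  have : Ntriple (a, c, c) = 3 := by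
    have e : ({(a, c, c), (a, c, c), (c, a, c), (c, c, a), (c, a, c), (c, c, a)} :
        Finset (ℕ × ℕ × ℕ)) = {(a, c, c), (c, a, c), (c, c, a)} := by
      ext x; simp only [Finset.mem_insert, Finset.mem_singleton]; tauto
    simp only [Ntriple, e]
    simp [Finset.card_insert_of_notMem, h3, h3.symm]
  rw [thetaTri, this]; norm_num

theorem theta_eq (a : ℕ) : thetaTri (a, a, a) = 1 / 3 := by
  simp [thetaTri, Ntriple]

/-- Symmetric count: unordered pairs with sum `s` and least part `≥ L`, weighted. -/
theorem sum_pairs (s L : ℕ) (h : 2 * L ≤ s + 1) :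
    ∑ a ∈ Finset.Icc L (s / 2), (if 2 * a = s then (1 : ℝ) else 2) = (s : ℝ) - 2 * L + 1 := by
  obtain ⟨d, hd⟩ : ∃ d, d = s / 2 + 1 - L := ⟨_, rfl⟩
  induction d generalizing L with
  | zero =>
    rw [Finset.Icc_eq_empty (by omega), Finset.sum_empty]
    have : s + 1 = 2 * L := by omega
    have : (s : ℝ) + 1 = 2 * L := by exact_mod_cast this
    linarith
  | succ d ih =>
    rw [← Finset.add_sum_Ioc_eq_sum_Icc (by omega),
      show Finset.Ioc L (s / 2) = Finset.Icc (L + 1) (s / 2) by ext; simp only [Finset.mem_Ioc, Finset.mem_Icc]; omega]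
    by_cases h2 : 2 * L = s
    · rw [Finset.Icc_eq_empty (by omega), if_pos h2, ← h2]
      simp
    · rw [ih (L + 1) (by omega) (by omega), if_neg h2]
      push_cast; ring

theorem sum_one (n j : ℕ) (hj : 1 ≤ j) (S : Finset (ℕ × ℕ × ℕ))
    (hS : ∀ a b c, (a, b, c) ∈ S ↔ 1 ≤ a ∧ a ≤ b ∧ c = j ∧ a + b = j) :
    ∑ p ∈ S, thetaTri p = (j : ℝ) - 1 := by
  have e : S = (Finset.Icc 1 (j / 2)).image fun a => (a, j - a, j) := by
    ext ⟨a, b, c⟩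
    rw [hS]
    simp only [Finset.mem_image, Finset.mem_Icc, Prod.mk.injEq]
    constructor
    · intro h; exact ⟨a, by omega, by omega, by omega, by omega⟩
    · rintro ⟨x, h⟩; omega
  rw [e, Finset.sum_image (by intro x _ y _ h; exact (Prod.mk.inj h).1)]
  have := sum_pairs j 1 (by omega)
  rw [show (j : ℝ) - 1 = (j : ℝ) - 2 * (1 : ℕ) + 1 by push_cast; ring, ← this]
  refine Finset.sum_congr rfl fun a ha => ?_
  rw [Finset.mem_Icc] at ha
  split_ifs with h
  · rw [show j - a = a by omega]; exact theta_left (by omega)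
  · exact theta_lt (by omega) (by omega)

theorem sum_two (n j : ℕ) (hn : 3 * j > n) (hj' : 2 * j < n) (S : Finset (ℕ × ℕ × ℕ))
    (hS : ∀ a b c, (a, b, c) ∈ S ↔ 1 ≤ a ∧ a ≤ b ∧ b ≤ j ∧ c = j ∧ a + b + j = n) :
    ∑ p ∈ S, thetaTri p = 3 * (j : ℝ) - n := by
  have e : S = (Finset.Icc (n - 2 * j) ((n - j) / 2)).image fun a => (a, n - j - a, j) := by
    ext ⟨a, b, c⟩
    rw [hS]
    simp only [Finset.mem_image, Finset.mem_Icc, Prod.mk.injEq]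
    constructor
    · intro h; exact ⟨a, by omega, by omega, by omega, by omega⟩
    · rintro ⟨x, h⟩; omega
  rw [e, Finset.sum_image (by intro x _ y _ h; exact (Prod.mk.inj h).1)]
  rw [← Finset.add_sum_Ioc_eq_sum_Icc (by omega),
    show Finset.Ioc (n - 2 * j) ((n - j) / 2) = Finset.Icc (n - 2 * j + 1) ((n - j) / 2) by
      ext; simp only [Finset.mem_Ioc, Finset.mem_Icc]; omega]
  have := sum_pairs (n - j) (n - 2 * j + 1) (by omega)
  rw [show n - j - (n - 2 * j) = j by omega, theta_right (by omega)]
  rw [Finset.sum_congr rfl (g := fun a => if 2 * a = n - j then (1 : ℝ) else 2), this]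
  · push_cast [Nat.cast_sub (show j ≤ n by omega), Nat.cast_sub (show 2 * j ≤ n by omega)]
    ring
  · intro a ha
    rw [Finset.mem_Icc] at ha
    split_ifs with h
    · rw [show n - j - a = a by omega]; exact theta_left (by omega)
    · exact theta_lt (by omega) (by omega)

/-- Counting lemma: for `n ≥ 4` and `1 ≤ j ≤ ⌊(n−1)/2⌋`,
`M_j^{(1)} = ∑_{(a,b,j)∈E_n^{(1)}} θ = j−1`,
`M_j^{(2)} = ∑_{(a,b,j)∈E_n^{(2)}} θ = 0` if `3j < n`, `1/3` if `3j = n`, `3j−n` if `3j > n`;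
and for even `n = 2m`, `M_m^{(3)} = ∑_{(a,b,m)∈E_n^{(3)}} θ = m−1`. -/
theorem counting_Mj (n : ℕ) (hn : 4 ≤ n) :
    (∀ j : ℕ, 1 ≤ j → j ≤ (n - 1) / 2 →
      (∑ p ∈ (Etri n).filter fun p => p.2.2 = j ∧ p.1 + p.2.1 = p.2.2, thetaTri p)
          = (j : ℝ) - 1 ∧
      (∑ p ∈ (Etri n).filter fun p => p.2.2 = j ∧ p.1 + p.2.1 + p.2.2 = n, thetaTri p)
          = if 3 * j < n then (0 : ℝ) else if 3 * j = n then 1 / 3 else 3 * (j : ℝ) - n) ∧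
    (n % 2 = 0 →
      (∑ p ∈ (Etri n).filter fun p => p.2.2 = n / 2 ∧ p.1 + p.2.1 = n / 2, thetaTri p)
        = ((n / 2 : ℕ) : ℝ) - 1) := by
  refine ⟨fun j hj hj' => ⟨?_, ?_⟩, fun he => ?_⟩
  · refine sum_one n j hj _ fun a b c => ?_
    simp only [Etri, Finset.mem_filter, Finset.mem_product, Finset.mem_range]
    omega
  · have hS : ∀ a b c, (a, b, c) ∈
        ((Etri n).filter fun p => p.2.2 = j ∧ p.1 + p.2.1 + p.2.2 = n) ↔
          1 ≤ a ∧ a ≤ b ∧ b ≤ j ∧ c = j ∧ a + b + j = n := by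
      intro a b c
      simp only [Etri, Finset.mem_filter, Finset.mem_product, Finset.mem_range]
      omega
    split_ifs with h1 h2
    · refine Finset.sum_eq_zero ?_
      rintro ⟨a, b, c⟩ h
      rw [hS] at h
      omega
    · rw [show ((Etri n).filter fun p => p.2.2 = j ∧ p.1 + p.2.1 + p.2.2 = n) = {(j, j, j)} by
        ext ⟨a, b, c⟩
        rw [hS]
        simp only [Finset.mem_singleton, Prod.mk.injEq]
        omega]
      rw [Finset.sum_singleton, theta_eq]
    · exact sum_two n j (by omega) (by omega) _ hS
  · refine sum_one n (n / 2) (by omega) _ fun a b c => ?_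
    simp only [Etri, Finset.mem_filter, Finset.mem_product, Finset.mem_range]
    omega
end

section
/- Let n = 2m+1 be odd with n ≥ 7, and define Δ_n = B_m − 2·(m−1)·sin²(πm/n), where B_m = ∑_{(a,b) : (a,b,m) ∈ E_n^{(1)}∪E_n^{(2)}} θ_{n,(a,b,m)}·A_{n,(a,b,m)}^{(c)}. Then 0 < Δ_n ≤ (m−1)·cos²(πm/n) < 1/4, and moreover 0 < Δ_n / A_{n,(2,m−1,m)}^{(c)} < 1. -/
lemma Ntriple_distinct {a b c : ℕ} (h1 : a < b) (h2 : b < c) : Ntriple (a, b, c) = 6 := by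
  have e1 : a ≠ b := by omega
  have e2 : b ≠ c := by omega
  have e3 : a ≠ c := by omega
  unfold Ntriple
  simp [Finset.card_insert_of_notMem, e1, e2, e3, e1.symm, e2.symm, e3.symm]

lemma Ntriple_left {a c : ℕ} (h : a < c) : Ntriple (a, a, c) = 3 := by
  have e3 : a ≠ c := by omega
  unfold Ntriple
  have : ({(a, a, c), (a, c, a), (a, a, c), (a, c, a), (c, a, a), (c, a, a)} :
      Finset (ℕ × ℕ × ℕ)) = {(a, a, c), (a, c, a), (c, a, a)} := by
    ext x; simp only [Finset.mem_insert, Finset.mem_singleton]; tauto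
  simp only [this]
  simp [Finset.card_insert_of_notMem, e3, e3.symm]

lemma Ntriple_right {a c : ℕ} (h : a < c) : Ntriple (a, c, c) = 3 := by
  have e3 : a ≠ c := by omega
  unfold Ntriple
  have : ({(a, c, c), (a, c, c), (c, a, c), (c, c, a), (c, a, c), (c, c, a)} :
      Finset (ℕ × ℕ × ℕ)) = {(a, c, c), (c, a, c), (c, c, a)} := by
    ext x; simp only [Finset.mem_insert, Finset.mem_singleton]; tauto
  simp only [this]
  simp [Finset.card_insert_of_notMem, e3, e3.symm]

lemma mem_F {m n : ℕ} (hn : n = 2 * m + 1) (p : ℕ × ℕ × ℕ) :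
    p ∈ (Etri n).filter (fun p => p.2.2 = m) ↔
      1 ≤ p.1 ∧ p.1 ≤ p.2.1 ∧ p.2.1 ≤ m ∧ p.2.2 = m ∧
        (p.1 + p.2.1 = m ∨ p.1 + p.2.1 = m + 1) := by
  unfold Etri
  simp only [Finset.mem_filter, Finset.mem_product, Finset.mem_range]
  omega

lemma F_eq {m n : ℕ} (hm : 3 ≤ m) (hn : n = 2 * m + 1) :
    (Etri n).filter (fun p => p.2.2 = m) =
      (Finset.Icc 1 (m / 2)).image (fun a => (a, m - a, m)) ∪
      (Finset.Icc 1 ((m + 1) / 2)).image (fun a => (a, m + 1 - a, m)) := by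
  ext ⟨a, b, c⟩
  rw [mem_F hn]
  simp only [Finset.mem_union, Finset.mem_image, Finset.mem_Icc, Prod.mk.injEq]
  constructor
  · rintro ⟨h1, h2, h3, h4, h5 | h5⟩
    · left; exact ⟨a, by omega, rfl, by omega, by omega⟩
    · right; exact ⟨a, by omega, rfl, by omega, by omega⟩
  · rintro (⟨x, h⟩ | ⟨x, h⟩) <;> omega

lemma sum_N {m n : ℕ} (hm : 3 ≤ m) (hn : n = 2 * m + 1) :
    ∑ p ∈ (Etri n).filter (fun p => p.2.2 = m), Ntriple p = 6 * (m - 1) := by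
  rw [F_eq hm hn, Finset.sum_union, Finset.sum_image, Finset.sum_image]
  · have h1 : ∑ a ∈ Finset.Icc 1 (m / 2), Ntriple (a, m - a, m) + (if m % 2 = 0 then 3 else 0)
        = 6 * (m / 2) := by
      have : ∀ a ∈ Finset.Icc 1 (m / 2), Ntriple (a, m - a, m) +
          (if a = m / 2 then (if m % 2 = 0 then 3 else 0) else 0) = 6 := by
        intro a ha
        rw [Finset.mem_Icc] at ha
        by_cases h : 2 * a = m
        · have e : m - a = a := by omega
          rw [e, Ntriple_left (by omega), if_pos (by omega), if_pos (by omega)]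
        · rw [Ntriple_distinct (by omega) (by omega)]
          split_ifs <;> omega
      have h := Finset.sum_congr rfl this
      rw [Finset.sum_add_distrib, Finset.sum_ite_eq', if_pos (by rw [Finset.mem_Icc]; omega)] at h
      rw [h]; simp [mul_comm]
    have h2 : ∑ a ∈ Finset.Icc 1 ((m + 1) / 2), Ntriple (a, m + 1 - a, m)
        + (if m % 2 = 1 then 3 else 0) + 3 = 6 * ((m + 1) / 2) := by
      have : ∀ a ∈ Finset.Icc 1 ((m + 1) / 2), Ntriple (a, m + 1 - a, m) +
          (if a = (m + 1) / 2 then (if m % 2 = 1 then 3 else 0) else 0) +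
          (if a = 1 then 3 else 0) = 6 := by
        intro a ha
        rw [Finset.mem_Icc] at ha
        by_cases h0 : a = 1
        · subst h0
          rw [Nat.add_sub_cancel, Ntriple_right (by omega)]
          rw [if_neg (by omega)]; simp
        by_cases h : 2 * a = m + 1
        · have e : m + 1 - a = a := by omega
          rw [e, Ntriple_left (by omega), if_pos (by omega), if_pos (by omega), if_neg h0]
        · rw [Ntriple_distinct (by omega) (by omega)]
          split_ifs <;> omega
      have h := Finset.sum_congr rfl this
      rw [Finset.sum_add_distrib, Finset.sum_add_distrib, Finset.sum_ite_eq', Finset.sum_ite_eq',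
        if_pos (Finset.mem_Icc.2 (by omega) : (m + 1) / 2 ∈ Finset.Icc 1 ((m + 1) / 2)),
        if_pos (Finset.mem_Icc.2 (by omega) : 1 ∈ Finset.Icc 1 ((m + 1) / 2))] at h
      rw [h]; simp [mul_comm]
    split_ifs at h1 h2 <;> omega
  · intro x _ y _ h; simp only [Prod.mk.injEq] at h; exact h.1
  · intro x _ y _ h; simp only [Prod.mk.injEq] at h; exact h.1
  · rw [Finset.disjoint_left]
    rintro ⟨a, b, c⟩ h1 h2
    simp only [Finset.mem_image, Finset.mem_Icc, Prod.mk.injEq] at h1 h2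
    obtain ⟨x, h1⟩ := h1
    obtain ⟨y, h2⟩ := h2
    omega

lemma sin_sq_add (x y : ℝ) :
    Real.sin x ^ 2 + Real.sin y ^ 2 = 1 - Real.cos (x + y) * Real.cos (x - y) := by
  rw [Real.cos_add, Real.cos_sub]
  have h1 := Real.sin_sq_add_cos_sq x
  have h2 := Real.sin_sq_add_cos_sq y
  have h3 : Real.cos x ^ 2 = 1 - Real.sin x ^ 2 := by linarith
  have h4 : Real.cos y ^ 2 = 1 - Real.sin y ^ 2 := by linarith
  linear_combination (Real.cos y ^ 2) * h3 + (1 - Real.sin x ^ 2) * h4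

/-- The one-term estimate. -/
lemma term_bound (q c r s S : ℝ) (hq0 : 0 < q) (hq : q < 1) (hr : r = q ∨ r = -q)
    (hc : c ^ 2 ≤ 1) (hs : s = 1 - r * c) (hS : S = 1 - q ^ 2) :
    0 < s ∧ (s + S) ^ 2 / (4 * s) - S = (s - S) ^ 2 / (4 * s) ∧
      (s - S) ^ 2 / (4 * s) ≤ q ^ 2 / 2 := by
  have hr2 : r ^ 2 = q ^ 2 := by rcases hr with h | h <;> rw [h] <;> ring
  have hs0 : 0 < s := by
    have hab : |r * c| < 1 := by
      rw [← sq_lt_one_iff_abs_lt_one, mul_pow, hr2]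
      nlinarith [sq_nonneg c, sq_nonneg q]
    have := (abs_lt.mp hab).2
    linarith
  refine ⟨hs0, by field_simp; ring, ?_⟩
  rw [div_le_iff₀ (by linarith)]
  have e : (s - S) ^ 2 = q ^ 2 * (r - c) ^ 2 := by
    have : s - S = r * (r - c) := by rw [hs, hS, ← hr2]; ring
    rw [this, mul_pow, hr2]
  rw [e, hs]
  have : (r - c) ^ 2 ≤ 2 * (1 - r * c) := by nlinarith
  nlinarith [sq_nonneg q]

lemma q_facts {m n : ℕ} (hm : 3 ≤ m) (hn : n = 2 * m + 1) :
    0 < Real.cos (Real.pi * m / n) ∧ Real.cos (Real.pi * m / n) < 1 / 4 ∧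
      ((m : ℝ) - 1) * Real.cos (Real.pi * m / n) ^ 2 < 1 / 4 ∧
      Real.cos (Real.pi * (m + 1) / n) = - Real.cos (Real.pi * m / n) := by
  have hmr : (3 : ℝ) ≤ m := by exact_mod_cast hm
  have hnr : (n : ℝ) = 2 * m + 1 := by rw [hn]; push_cast; ring
  have hn0 : (0 : ℝ) < n := by rw [hnr]; linarith
  have e : Real.cos (Real.pi * m / n) = Real.sin (Real.pi / (2 * n)) := by
    rw [← Real.cos_pi_div_two_sub]
    congr 1
    field_simp
    rw [hnr]; ring
  have hpi := Real.pi_pos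
  have hpi2 := Real.pi_lt_d2
  have hx : 0 < Real.pi / (2 * n) := by positivity
  have hlt := Real.sin_lt hx
  have hx4 : Real.pi / (2 * n) < 1 / 4 := by
    rw [div_lt_iff₀ (by positivity), hnr]; linarith
  have hpos : 0 < Real.sin (Real.pi / (2 * n)) :=
    Real.sin_pos_of_pos_of_lt_pi hx (by linarith [Real.pi_gt_three])
  refine ⟨by rw [e]; exact hpos, by rw [e]; linarith, ?_, ?_⟩
  · rw [e]
    have h1 : Real.sin (Real.pi / (2 * n)) ^ 2 < (Real.pi / (2 * n)) ^ 2 := by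
      gcongr
    have h2 : ((m : ℝ) - 1) * (Real.pi / (2 * n)) ^ 2 < 1 / 4 := by
      rw [div_pow, mul_div_assoc', div_lt_iff₀ (by positivity), hnr]
      have : Real.pi ^ 2 < 10 := by nlinarith
      nlinarith
    nlinarith
  · rw [← Real.cos_pi_sub]
    congr 1
    field_simp
    rw [hnr]; ring

/-- Estimate for one triple. -/
lemma Ac_bound {m n a b : ℕ} (hm : 3 ≤ m) (hn : n = 2 * m + 1)
    (hab : a + b = m ∨ a + b = m + 1) :
    Real.sin (Real.pi * m / n) ^ 2 ≤ AcTri n (a, b, m) ∧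
    AcTri n (a, b, m) ≤
      Real.sin (Real.pi * m / n) ^ 2 + Real.cos (Real.pi * m / n) ^ 2 / 2 ∧
    (Real.sin (Real.pi * a / n) ^ 2 + Real.sin (Real.pi * b / n) ^ 2 ≠
      Real.sin (Real.pi * m / n) ^ 2 → Real.sin (Real.pi * m / n) ^ 2 < AcTri n (a, b, m)) := by
  obtain ⟨h0, h1, -, h2⟩ := q_facts hm hn
  have hs := sin_sq_add (Real.pi * a / n) (Real.pi * b / n)
  have hr : Real.cos (Real.pi * a / n + Real.pi * b / n) = Real.cos (Real.pi * m / n) ∨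
      Real.cos (Real.pi * a / n + Real.pi * b / n) = - Real.cos (Real.pi * m / n) := by
    have e : Real.pi * a / n + Real.pi * b / n = Real.pi * ((a + b : ℕ) : ℝ) / n := by
      push_cast; ring
    rw [e]
    rcases hab with h | h
    · left; rw [h]
    · right; rw [h, ← h2]; push_cast; rfl
  obtain ⟨k1, k2, k3⟩ := term_bound _ _ _ _ (Real.sin (Real.pi * m / n) ^ 2) h0 (by linarith) hr
    (Real.cos_sq_le_one _) hs (Real.sin_sq _)
  have hA : AcTri n (a, b, m) = (Real.sin (Real.pi * a / n) ^ 2 + Real.sin (Real.pi * b / n) ^ 2 +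
      Real.sin (Real.pi * m / n) ^ 2) ^ 2 /
      (4 * (Real.sin (Real.pi * a / n) ^ 2 + Real.sin (Real.pi * b / n) ^ 2)) := rfl
  rw [← hA] at k2
  refine ⟨?_, by linarith, ?_⟩
  · have := div_nonneg (sq_nonneg (Real.sin (Real.pi * a / n) ^ 2 +
      Real.sin (Real.pi * b / n) ^ 2 - Real.sin (Real.pi * m / n) ^ 2)) (by linarith : 0 ≤
      4 * (Real.sin (Real.pi * a / n) ^ 2 + Real.sin (Real.pi * b / n) ^ 2))
    linarith
  · intro hne
    have h3 := sub_ne_zero.mpr hne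
    have : 0 < (Real.sin (Real.pi * a / n) ^ 2 + Real.sin (Real.pi * b / n) ^ 2 -
      Real.sin (Real.pi * m / n) ^ 2) ^ 2 /
      (4 * (Real.sin (Real.pi * a / n) ^ 2 + Real.sin (Real.pi * b / n) ^ 2)) := by positivity
    linarith

lemma Ac_strict {m n : ℕ} (hm : 3 ≤ m) (hn : n = 2 * m + 1) :
    Real.sin (Real.pi * m / n) ^ 2 < AcTri n (1, m - 1, m) := by
  apply (Ac_bound hm hn (by omega)).2.2
  rw [sin_sq_add, Real.sin_sq]
  obtain ⟨h0, -, -, -⟩ := q_facts hm hn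
  have hmr : (3 : ℝ) ≤ m := by exact_mod_cast hm
  have hnr : (n : ℝ) = 2 * m + 1 := by rw [hn]; push_cast; ring
  have hn0 : (0 : ℝ) < n := by rw [hnr]; linarith
  have hpi := Real.pi_pos
  have e1 : Real.pi * (1 : ℕ) / n + Real.pi * ((m - 1 : ℕ) : ℝ) / n = Real.pi * m / n := by
    rw [Nat.cast_sub (by omega)]; push_cast; ring
  have e2 : Real.cos (Real.pi * (1 : ℕ) / n - Real.pi * ((m - 1 : ℕ) : ℝ) / n) =
      Real.cos (Real.pi * (m - 2) / n) := by
    rw [← Real.cos_neg]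
    congr 1
    rw [Nat.cast_sub (by omega)]; push_cast; ring
  rw [e1, e2]
  have : Real.cos (Real.pi * m / n) < Real.cos (Real.pi * (m - 2) / n) := by
    apply Real.cos_lt_cos_of_nonneg_of_le_pi
    · apply div_nonneg _ hn0.le
      apply mul_nonneg hpi.le; linarith
    · rw [div_le_iff₀ hn0]
      apply mul_le_mul_of_nonneg_left _ hpi.le
      linarith
    · gcongr; linarith
  intro h
  nlinarith

/-- For odd `n = 2m+1 ≥ 7`, with `B_m = ∑_{(a,b,m)∈E_n^{(1)}∪E_n^{(2)}} θ·A^{(c)}` and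
`Δ_n = B_m − 2(m−1)sin²(πm/n)`, one has `0 < Δ_n ≤ (m−1)cos²(πm/n) < 1/4` and
`0 < Δ_n / A_{n,(2,m−1,m)}^{(c)} < 1`. -/
theorem Delta_bounds_odd (m n : ℕ) (hm : 3 ≤ m) (hn : n = 2 * m + 1) :
    let B : ℝ := ∑ p ∈ (Etri n).filter fun p => p.2.2 = m, thetaTri p * AcTri n p
    let Δ : ℝ := B - 2 * ((m : ℝ) - 1) * Real.sin (Real.pi * m / n) ^ 2
    0 < Δ ∧ Δ ≤ ((m : ℝ) - 1) * Real.cos (Real.pi * m / n) ^ 2 ∧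
      ((m : ℝ) - 1) * Real.cos (Real.pi * m / n) ^ 2 < 1 / 4 ∧
      0 < Δ / AcTri n (2, m - 1, m) ∧ Δ / AcTri n (2, m - 1, m) < 1 := by
  intro B Δ
  obtain ⟨h0, h1, h2, -⟩ := q_facts hm hn
  have hmr : (3 : ℝ) ≤ m := by exact_mod_cast hm
  have hθ : ∑ p ∈ (Etri n).filter (fun p => p.2.2 = m), thetaTri p = 2 * ((m : ℝ) - 1) := by
    unfold thetaTri
    rw [← Finset.sum_div, ← Nat.cast_sum, sum_N hm hn, Nat.cast_mul, Nat.cast_sub (by omega)]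
    push_cast; ring
  have hΔ : Δ = ∑ p ∈ (Etri n).filter (fun p => p.2.2 = m),
      thetaTri p * (AcTri n p - Real.sin (Real.pi * m / n) ^ 2) := by
    have e : ∀ p, thetaTri p * (AcTri n p - Real.sin (Real.pi * m / n) ^ 2) =
        thetaTri p * AcTri n p - thetaTri p * Real.sin (Real.pi * m / n) ^ 2 :=
      fun p => mul_sub _ _ _
    simp only [e]
    rw [Finset.sum_sub_distrib, ← Finset.sum_mul, hθ]
  have hθ0 : ∀ p, 0 ≤ thetaTri p := fun p => by unfold thetaTri; positivity
  have hb : ∀ p ∈ (Etri n).filter (fun p => p.2.2 = m),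
      Real.sin (Real.pi * m / n) ^ 2 ≤ AcTri n p ∧ AcTri n p ≤
      Real.sin (Real.pi * m / n) ^ 2 + Real.cos (Real.pi * m / n) ^ 2 / 2 := by
    rintro ⟨a, b, c⟩ hp
    obtain ⟨-, -, -, hc, hab⟩ := (mem_F hn _).1 hp
    simp only at hc hab
    subst hc
    have := Ac_bound hm hn hab
    exact ⟨this.1, this.2.1⟩
  have hpos : 0 < Δ := by
    rw [hΔ]
    apply Finset.sum_pos'
    · intro p hp
      exact mul_nonneg (hθ0 p) (by linarith [(hb p hp).1])
    · refine ⟨(1, m - 1, m), (mem_F hn _).2 ?_, ?_⟩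
      · exact ⟨le_refl 1, show 1 ≤ m - 1 by omega, show m - 1 ≤ m by omega, rfl,
          Or.inl (show 1 + (m - 1) = m by omega)⟩
      · apply mul_pos _ (by linarith [Ac_strict hm hn])
        unfold thetaTri
        rw [Ntriple_distinct (by omega) (by omega)]
        norm_num
  have hle : Δ ≤ ((m : ℝ) - 1) * Real.cos (Real.pi * m / n) ^ 2 := by
    have : Δ ≤ ∑ p ∈ (Etri n).filter (fun p => p.2.2 = m),
        thetaTri p * (Real.cos (Real.pi * m / n) ^ 2 / 2) := by
      rw [hΔ]
      apply Finset.sum_le_sum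
      intro p hp
      exact mul_le_mul_of_nonneg_left (by linarith [(hb p hp).2]) (hθ0 p)
    rw [← Finset.sum_mul, hθ] at this
    linarith
  have hA : 1 / 4 < AcTri n (2, m - 1, m) := by
    have h := (Ac_bound (a := 2) (b := m - 1) hm hn (by omega)).1
    rw [Real.sin_sq] at h
    nlinarith
  refine ⟨hpos, hle, h2, div_pos hpos (by linarith), ?_⟩
  rw [div_lt_one (by linarith)]
  linarith
end

section
/- Let n = 2m be even with n ≥ 4. For 1 ≤ u ≤ v ≤ m−1 define L_{uv} = ∑_{c : (u,v,c) ∈ E_n^{(1)}∪E_n^{(2)}∪E_n^{(3)}} θ_{n,(u,v,c)}, and for 1 ≤ j ≤ m define R_j = ∑_{(a,b) : (a,b,j) ∈ E_n^{(1)}∪E_n^{(2)}∪E_n^{(3)}} θ_{n,(a,b,j)}·A_{n,(a,b,j)}^{(c)}. Assume: (1) L_{uv} ≤ 2 for all 1 ≤ u < v ≤ m−1; (2) L_{uu} ≤ 1 for all 1 ≤ u ≤ m−1; (3) R_j ≤ 2·(j−1)·sin²(πj/n) for all 1 ≤ j ≤ m−1; (4) R_m ≤ m−1. Then Q_{n,2}(x)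 + Q_{n,4}(x) − Q_{n,3}(x) ≥ 0 for all x ∈ ℝ_+^m. -/
lemma aux_amgm (t w P X S : ℝ) (ht : 0 ≤ t) (hS : 0 < S) :
    t * (w * P * X) ≤ t * (w ^ 2 / (4 * S)) * X ^ 2 + t * (S * P ^ 2) := by
  have h : w * P * X ≤ w ^ 2 / (4 * S) * X ^ 2 + S * P ^ 2 := by
    have e : w ^ 2 / (4 * S) * X ^ 2 + S * P ^ 2 - w * P * X
        = (w * X - 2 * S * P) ^ 2 / (4 * S) := by
      field_simp
      ring
    have : 0 ≤ (w * X - 2 * S * P) ^ 2 / (4 * S) := by positivity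
    linarith
  have := mul_le_mul_of_nonneg_left h ht
  linarith

lemma aux_sq (I : Finset ℕ) (s y : ℕ → ℝ) (hs : ∀ i, 0 ≤ s i) (hy : ∀ i, 0 ≤ y i)
    (L : ℕ → ℕ → ℝ) (h1 : ∀ u ∈ I, ∀ v ∈ I, u < v → L u v ≤ 2)
    (h2 : ∀ u ∈ I, L u u ≤ 1) (h3 : ∀ u ∈ I, ∀ v ∈ I, v < u → L u v ≤ 0) :
    ∑ u ∈ I, ∑ v ∈ I, L u v * ((s u + s v) * (y u * y v))
      ≤ 2 * (∑ u ∈ I, y u) * (∑ u ∈ I, s u * y u) := by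
  have e1 : ∑ u ∈ I, ∑ v ∈ I, (s u + s v) * (y u * y v)
      = 2 * (∑ u ∈ I, y u) * (∑ u ∈ I, s u * y u) := by
    have a1 : ∑ u ∈ I, ∑ v ∈ I, (s u * y u) * y v = (∑ u ∈ I, s u * y u) * ∑ u ∈ I, y u :=
      (Finset.sum_mul_sum _ _ _ _).symm
    have a2 : ∑ u ∈ I, ∑ v ∈ I, y u * (s v * y v) = (∑ u ∈ I, y u) * ∑ u ∈ I, s u * y u :=
      (Finset.sum_mul_sum _ _ _ _).symm
    have a3 : ∑ u ∈ I, ∑ v ∈ I, (s u + s v) * (y u * y v)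
        = ∑ u ∈ I, ∑ v ∈ I, (s u * y u) * y v + ∑ u ∈ I, ∑ v ∈ I, y u * (s v * y v) := by
      simp only [← Finset.sum_add_distrib]
      refine Finset.sum_congr rfl fun u _ => Finset.sum_congr rfl fun v _ => by ring
    rw [a3, a1, a2]
    ring
  have e2 : ∑ u ∈ I, ∑ v ∈ I, L u v * ((s u + s v) * (y u * y v))
      = ∑ u ∈ I, ∑ v ∈ I, L v u * ((s u + s v) * (y u * y v)) := by
    rw [Finset.sum_comm]
    refine Finset.sum_congr rfl fun u _ => Finset.sum_congr rfl fun v _ => by ring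
  have e3 : ∑ u ∈ I, ∑ v ∈ I, L u v * ((s u + s v) * (y u * y v))
      + ∑ u ∈ I, ∑ v ∈ I, L v u * ((s u + s v) * (y u * y v))
      ≤ ∑ u ∈ I, ∑ v ∈ I, (s u + s v) * (y u * y v)
        + ∑ u ∈ I, ∑ v ∈ I, (s u + s v) * (y u * y v) := by
    simp only [← Finset.sum_add_distrib]
    refine Finset.sum_le_sum fun u hu => Finset.sum_le_sum fun v hv => ?_
    have hF : 0 ≤ (s u + s v) * (y u * y v) :=
      mul_nonneg (add_nonneg (hs u) (hs v)) (mul_nonneg (hy u) (hy v))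
    have hL : L u v + L v u ≤ 2 := by
      rcases lt_trichotomy u v with h | h | h
      · linarith [h1 u hu v hv h, h3 v hv u hu h]
      · subst h
        linarith [h2 u hu]
      · linarith [h1 v hv u hu h, h3 u hu v hv h]
    nlinarith [mul_le_mul_of_nonneg_right hL hF]
  linarith

/-- Sufficient criterion (even case `n = 2m ≥ 4`): with
`L_{uv} = ∑_{c : (u,v,c)∈E_n} θ_{n,(u,v,c)}` and `R_j = ∑_{(a,b) : (a,b,j)∈E_n} θ·A^{(c)}`
over `E_n = E_n^{(1)} ∪ E_n^{(2)} ∪ E_n^{(3)}`, if `L_{uv} ≤ 2` for `u < v`, `L_{uu} ≤ 1`,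
`R_j ≤ 2(j−1)sin²(πj/n)` for `j ≤ m−1` and `R_m ≤ m−1`, then
`Q_{n,2}(x) + Q_{n,4}(x) − Q_{n,3}(x) ≥ 0` for all `x ∈ ℝ_+^m`. -/
theorem criterion_even (m n : ℕ) (hm : 2 ≤ m) (hn : n = 2 * m)
    (hLlt : ∀ u v : ℕ, 1 ≤ u → u < v → v ≤ m - 1 →
      (∑ p ∈ (Etri n).filter fun p => p.1 = u ∧ p.2.1 = v, thetaTri p) ≤ 2)
    (hLeq : ∀ u : ℕ, 1 ≤ u → u ≤ m - 1 →
      (∑ p ∈ (Etri n).filter fun p => p.1 = u ∧ p.2.1 = u, thetaTri p) ≤ 1)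
    (hR : ∀ j : ℕ, 1 ≤ j → j ≤ m - 1 →
      (∑ p ∈ (Etri n).filter fun p => p.2.2 = j, thetaTri p * AcTri n p)
        ≤ 2 * ((j : ℝ) - 1) * Real.sin (Real.pi * j / n) ^ 2)
    (hRm : (∑ p ∈ (Etri n).filter fun p => p.2.2 = m, thetaTri p * AcTri n p) ≤ (m : ℝ) - 1)
    (x : ℕ → ℝ) (hx : ∀ i, 0 ≤ x i) :
    0 ≤ Q2 n x + Q4 n x - Q3 n x := by
  have hnpos : (0 : ℝ) < n := by
    have : 0 < n := by omega
    exact_mod_cast this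
  have hn2 : n / 2 = m := by omega
  have hodd : ¬ (n % 2 = 1) := by omega
  set s : ℕ → ℝ := fun k => Real.sin (Real.pi * k / n) ^ 2 with hs
  have hs0 : ∀ k, 0 ≤ s k := fun k => sq_nonneg _
  have hspos : ∀ k, 1 ≤ k → k < n → 0 < s k := by
    intro k h1 h2
    have h1' : (0 : ℝ) < k := by exact_mod_cast h1
    have h2' : (k : ℝ) < n := by exact_mod_cast h2
    have : 0 < Real.sin (Real.pi * k / n) := by
      apply Real.sin_pos_of_pos_of_lt_pi
      · have := Real.pi_pos
        positivity
      · rw [div_lt_iff₀ hnpos]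
        exact mul_lt_mul_of_pos_left h2' Real.pi_pos
    exact pow_pos this 2
  have hE : ∀ p ∈ Etri n, 1 ≤ p.1 ∧ p.1 ≤ p.2.1 ∧ p.2.1 ≤ m - 1 ∧ 1 ≤ p.2.2 ∧ p.2.2 ≤ m := by
    intro p hp
    simp only [Etri, Finset.mem_filter, Finset.mem_product, Finset.mem_range] at hp
    omega
  have hth : ∀ p, 0 ≤ thetaTri p := fun p => by unfold thetaTri; positivity
  have hpt : ∀ p ∈ Etri n, thetaTri p * wTri n p * x p.1 * x p.2.1 * x p.2.2 * (1 / (n : ℝ) ^ 3)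
      ≤ (thetaTri p * AcTri n p) * (x p.2.2 ^ 2 * (1 / (n : ℝ) ^ 2))
        + thetaTri p * ((s p.1 + s p.2.1) * (x p.1 ^ 2 * x p.2.1 ^ 2)) * (1 / (n : ℝ) ^ 4) := by
    intro p hp
    obtain ⟨h1, h2, h3, h4, h5⟩ := hE p hp
    have hS : 0 < s p.1 + s p.2.1 := by
      linarith [hspos p.1 h1 (by omega), hs0 p.2.1]
    have := aux_amgm (thetaTri p) (wTri n p) (x p.1 * x p.2.1 * (1 / (n : ℝ) ^ 2))
      (x p.2.2 * (1 / (n : ℝ))) (s p.1 + s p.2.1) (hth p) hS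
    have hA : AcTri n p = wTri n p ^ 2 / (4 * (s p.1 + s p.2.1)) := rfl
    rw [hA]
    calc _ = _ := ?_
      _ ≤ _ := this
      _ = _ := ?_
    · field_simp
    · field_simp
  have hsum := Finset.sum_le_sum hpt
  rw [Finset.sum_add_distrib, ← Finset.sum_mul, ← Finset.sum_mul] at hsum
  -- the quadratic part
  have hpart2 : ∑ p ∈ Etri n, (thetaTri p * AcTri n p) * (x p.2.2 ^ 2 * (1 / (n : ℝ) ^ 2))
      ≤ Q2 n x := by
    rw [← Finset.sum_fiberwise_of_maps_to (s := Etri n) (t := Finset.Icc 1 m)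
      (g := fun p => p.2.2) (fun p hp => Finset.mem_Icc.2 ⟨(hE p hp).2.2.2.1, (hE p hp).2.2.2.2⟩)]
    have hfib : ∀ j, ∑ p ∈ (Etri n).filter (fun p => p.2.2 = j),
        (thetaTri p * AcTri n p) * (x p.2.2 ^ 2 * (1 / (n : ℝ) ^ 2))
        = (∑ p ∈ (Etri n).filter (fun p => p.2.2 = j), thetaTri p * AcTri n p)
          * (x j ^ 2 * (1 / (n : ℝ) ^ 2)) := by
      intro j
      rw [Finset.sum_mul]
      refine Finset.sum_congr rfl fun p hp => ?_
      rw [(Finset.mem_filter.1 hp).2]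
    simp only [hfib]
    obtain ⟨k, rfl⟩ : ∃ k, m = k + 1 := ⟨m - 1, by omega⟩
    rw [Finset.sum_Icc_succ_top (by omega)]
    unfold Q2
    rw [if_neg hodd, hn2, Nat.add_sub_cancel, Finset.mul_sum]
    apply add_le_add
    · refine Finset.sum_le_sum fun j hj => ?_
      have hj' := Finset.mem_Icc.1 hj
      have h := hR j hj'.1 (by omega)
      have := mul_le_mul_of_nonneg_right h
        (show 0 ≤ x j ^ 2 * (1 / (n : ℝ) ^ 2) by positivity)
      refine this.trans (le_of_eq ?_)
      ring
    · have := mul_le_mul_of_nonneg_right hRm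
        (show 0 ≤ x (k + 1) ^ 2 * (1 / (n : ℝ) ^ 2) by positivity)
      refine this.trans (le_of_eq ?_)
      ring
  have hpart4 : (∑ p ∈ Etri n, thetaTri p * ((s p.1 + s p.2.1) * (x p.1 ^ 2 * x p.2.1 ^ 2)))
      ≤ 2 * (∑ u ∈ Finset.Icc 1 (m - 1), x u ^ 2)
        * (∑ u ∈ Finset.Icc 1 (m - 1), s u * x u ^ 2) := by
    refine le_trans (le_of_eq ?_) (aux_sq (Finset.Icc 1 (m - 1)) s (fun k => x k ^ 2) hs0
      (fun _ => sq_nonneg _)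
      (fun u v => ∑ p ∈ (Etri n).filter (fun p => p.1 = u ∧ p.2.1 = v), thetaTri p)
      ?_ ?_ ?_)
    · rw [← Finset.sum_fiberwise_of_maps_to (s := Etri n)
        (t := Finset.Icc 1 (m - 1) ×ˢ Finset.Icc 1 (m - 1))
        (g := fun p => (p.1, p.2.1)) (fun p hp => by
          have := hE p hp
          simp only [Finset.mem_product, Finset.mem_Icc]
          omega), Finset.sum_product]
      refine Finset.sum_congr rfl fun u _ => Finset.sum_congr rfl fun v _ => ?_
      simp only [Prod.mk.injEq]
      rw [Finset.sum_mul]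
      refine Finset.sum_congr rfl fun p hp => ?_
      obtain ⟨h1, h2⟩ := (Finset.mem_filter.1 hp).2
      rw [h1, h2]
    · intro u hu v hv huv
      exact hLlt u v (Finset.mem_Icc.1 hu).1 huv (Finset.mem_Icc.1 hv).2
    · intro u hu
      exact hLeq u (Finset.mem_Icc.1 hu).1 (Finset.mem_Icc.1 hu).2
    · intro u hu v hv huv
      refine le_of_eq (Finset.sum_eq_zero fun p hp => ?_)
      obtain ⟨hp, h1, h2⟩ := Finset.mem_filter.1 hp
      have := hE p hp
      omega
  have hQ4 : (∑ p ∈ Etri n, thetaTri p * ((s p.1 + s p.2.1) * (x p.1 ^ 2 * x p.2.1 ^ 2)))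
      * (1 / (n : ℝ) ^ 4) ≤ Q4 n x := by
    have hc : (0 : ℝ) ≤ 1 / (n : ℝ) ^ 4 := by positivity
    refine (mul_le_mul_of_nonneg_right hpart4 hc).trans ?_
    unfold Q4
    rw [if_neg hodd, hn2]
    change _ ≤ 2 / (n : ℝ) ^ 4 * ((∑ k ∈ Finset.Icc 1 (m - 1), x k ^ 2) + x m ^ 2 / 2) *
      ((∑ k ∈ Finset.Icc 1 (m - 1), s k * x k ^ 2) + x m ^ 2 / 2)
    have hB : 0 ≤ ∑ k ∈ Finset.Icc 1 (m - 1), x k ^ 2 := Finset.sum_nonneg fun _ _ => sq_nonneg _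
    have hC : 0 ≤ ∑ k ∈ Finset.Icc 1 (m - 1), s k * x k ^ 2 :=
      Finset.sum_nonneg fun k _ => mul_nonneg (hs0 k) (sq_nonneg _)
    have hz : 0 ≤ x m ^ 2 / 2 := by positivity
    have := mul_le_mul (le_add_of_nonneg_right (a := ∑ k ∈ Finset.Icc 1 (m - 1), x k ^ 2) hz)
      (le_add_of_nonneg_right (a := ∑ k ∈ Finset.Icc 1 (m - 1), s k * x k ^ 2) hz) hC
      (add_nonneg hB hz)
    have h2 := mul_le_mul_of_nonneg_left this (show (0 : ℝ) ≤ 2 / (n : ℝ) ^ 4 by positivity)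
    calc _ = _ := ?_
      _ ≤ _ := h2
      _ = _ := ?_
    · ring
    · ring
  have hQ3 : Q3 n x = (∑ p ∈ Etri n, thetaTri p * wTri n p * x p.1 * x p.2.1 * x p.2.2)
      * (1 / (n : ℝ) ^ 3) := by
    unfold Q3
    ring
  linarith
end
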